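/- Let n ≥ 5. There exist ε₀ > 0 and a constant C > 0 depending only on n and ε₀ such that for every p on the critical hyperbola with |p − 1| ≤ ε₀ and q = q(p), the ground state satisfies ∫_{ℝⁿ} U_p^{q+1} dx ≤ C. -/

import Mathlib

open Filter MeasureTheory Topology

noncomputable def lap {n : ℕ} (f : EuclideanSpace ℝ (Fin n) → ℝ)
    (x : EuclideanSpace ℝ (Fin n)) : ℝ :=
  ∑ i, fderiv ℝ (fderiv ℝ f) x (EuclideanSpace.single i 1) (EuclideanSpace.single i 1)

def IsGroundState (n : ℕ) (p q : ℝ) (U V : EuclideanSpace ℝ (Fin n) → ℝ) : Prop :=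
  ContDiff ℝ 2 U ∧ ContDiff ℝ 2 V ∧
  (∀ x, 0 < U x) ∧ (∀ x, 0 < V x) ∧
  (∀ x, -lap U x = V x ^ p) ∧ (∀ x, -lap V x = U x ^ q) ∧
  (∀ x y, ‖x‖ ≤ ‖y‖ → U y ≤ U x) ∧
  (∀ x y, ‖x‖ ≤ ‖y‖ → V y ≤ V x) ∧
  Tendsto U (cocompact _) (nhds 0) ∧
  Tendsto V (cocompact _) (nhds 0) ∧
  U 0 = 1
/-- Radial profile: `f` is twice differentiable with derivatives `f1`, `f2` and its radial
Laplacian in dimension `n` equals `F` on `r > 0`. -/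
structure Rad (n : ℕ) (f f1 f2 F : ℝ → ℝ) : Prop where
  d1 : ∀ r, HasDerivAt f (f1 r) r
  d2 : ∀ r, HasDerivAt f1 (f2 r) r
  eq : ∀ r, 0 < r → r * f2 r + ((n : ℝ) - 1) * f1 r = r * F r

lemma Rad.add {n : ℕ} {f f1 f2 F g g1 g2 G : ℝ → ℝ} (hf : Rad n f f1 f2 F)
    (hg : Rad n g g1 g2 G) :
    Rad n (fun r => f r + g r) (fun r => f1 r + g1 r) (fun r => f2 r + g2 r)
      (fun r => F r + G r) where
  d1 r := (hf.d1 r).add (hg.d1 r)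
  d2 r := (hf.d2 r).add (hg.d2 r)
  eq r hr := by linear_combination hf.eq r hr + hg.eq r hr

lemma Rad.smul {n : ℕ} {f f1 f2 F : ℝ → ℝ} (c : ℝ) (hf : Rad n f f1 f2 F) :
    Rad n (fun r => c * f r) (fun r => c * f1 r) (fun r => c * f2 r)
      (fun r => c * F r) where
  d1 r := (hf.d1 r).const_mul c
  d2 r := (hf.d2 r).const_mul c
  eq r hr := by linear_combination c * hf.eq r hr

lemma Rad.congrF {n : ℕ} {f f1 f2 F G : ℝ → ℝ} (hf : Rad n f f1 f2 F)
    (h : ∀ r, 0 < r → F r = G r) : Rad n f f1 f2 G where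
  d1 := hf.d1
  d2 := hf.d2
  eq r hr := by rw [hf.eq r hr, h r hr]

lemma Rad.quad (n : ℕ) (a b : ℝ) :
    Rad n (fun r => a + b * r ^ 2) (fun r => 2 * b * r) (fun _ => 2 * b)
      (fun _ => 2 * n * b) where
  d1 r := by
    have h : HasDerivAt (fun r : ℝ => a + b * r ^ 2) (b * ((2 : ℕ) * r ^ (2 - 1))) r :=
      ((hasDerivAt_pow 2 r).const_mul b).const_add a
    exact h.congr_deriv (by norm_num; ring)
  d2 r := by
    have h : HasDerivAt (fun r : ℝ => 2 * b * r) (2 * b * 1) r := (hasDerivAt_id r).const_mul (2 * b)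
    exact h.congr_deriv (by ring)
  eq r hr := by ring

lemma Rad.cont {n : ℕ} {f f1 f2 F : ℝ → ℝ} (hf : Rad n f f1 f2 F) : Continuous f :=
  continuous_iff_continuousAt.2 fun r => (hf.d1 r).continuousAt

lemma Rad.cont1 {n : ℕ} {f f1 f2 F : ℝ → ℝ} (hf : Rad n f f1 f2 F) : Continuous f1 :=
  continuous_iff_continuousAt.2 fun r => (hf.d2 r).continuousAt

/-- monotonicity of radially subharmonic functions -/
lemma Rad.deriv_nonneg {n : ℕ} (hn : 2 ≤ n) {f f1 f2 F : ℝ → ℝ} (hf : Rad n f f1 f2 F) {R : ℝ}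
    (hF : ∀ r, 0 < r → r < R → 0 ≤ F r) : ∀ r, 0 < r → r ≤ R → 0 ≤ f1 r := by
  obtain ⟨k, rfl⟩ := Nat.exists_eq_add_of_le' hn
  have hd : ∀ r, HasDerivAt (fun r => r ^ (k + 1) * f1 r)
      ((k + 1 : ℕ) * r ^ k * f1 r + r ^ (k + 1) * f2 r) r := by
    intro r
    exact (hasDerivAt_pow (k + 1) r).mul (hf.d2 r)
  have hm : MonotoneOn (fun r => r ^ (k + 1) * f1 r) (Set.Icc 0 R) := by
    apply monotoneOn_of_deriv_nonneg (convex_Icc 0 R)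
    · exact fun r _ => (hd r).continuousAt.continuousWithinAt
    · exact fun r _ => (hd r).differentiableAt.differentiableWithinAt
    · intro r hr
      rw [interior_Icc] at hr
      rw [(hd r).deriv]
      have e := hf.eq r hr.1
      have : ((k + 1 : ℕ) : ℝ) * r ^ k * f1 r + r ^ (k + 1) * f2 r = r ^ k * (r * F r) := by
        rw [← e]; push_cast; ring
      rw [this]
      have := hF r hr.1 hr.2
      have := hr.1
      positivity
  intro r hr hrR
  have := hm ⟨le_refl 0, hr.le.trans hrR⟩ ⟨hr.le, hrR⟩ hr.le
  simp at this
  exact nonneg_of_mul_nonneg_right this (pow_pos hr _)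

lemma Rad.mono {n : ℕ} (hn : 2 ≤ n) {f f1 f2 F : ℝ → ℝ} (hf : Rad n f f1 f2 F) {R : ℝ}
    (hF : ∀ r, 0 < r → r < R → 0 ≤ F r) : MonotoneOn f (Set.Icc 0 R) := by
  apply monotoneOn_of_deriv_nonneg (convex_Icc 0 R)
  · exact hf.cont.continuousOn
  · exact fun r _ => (hf.d1 r).differentiableAt.differentiableWithinAt
  · intro r hr
    rw [interior_Icc] at hr
    rw [(hf.d1 r).deriv]
    exact hf.deriv_nonneg hn hF r hr.1 hr.2.le

/-- comparison principle for cooperative radial systems -/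
lemma Rad.comparison {n : ℕ} (hn : 2 ≤ n) {f f1 f2 F g g1 g2 G : ℝ → ℝ}
    (hf : Rad n f f1 f2 F) (hg : Rad n g g1 g2 G) {R : ℝ}
    (f0 : 0 < f 0) (g0 : 0 < g 0)
    (h : ∀ r, 0 < r → r ≤ R → 0 < f r → 0 < g r → 0 ≤ F r ∧ 0 ≤ G r) :
    ∀ r, 0 < r → r ≤ R → 0 < f r ∧ 0 < g r ∧ 0 ≤ f1 r ∧ 0 ≤ g1 r := by
  have key : ∀ r, 0 ≤ r → r ≤ R → 0 < f r ∧ 0 < g r := by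
    by_contra hcon
    push Not at hcon
    obtain ⟨r0, hr0, hr0R, hbad⟩ := hcon
    set S : Set ℝ := Set.Icc 0 R ∩ {r | f r ≤ 0 ∨ g r ≤ 0} with hS
    have hSc : IsCompact S := by
      apply isCompact_Icc.inter_right
      exact (isClosed_le hf.cont continuous_const).union (isClosed_le hg.cont continuous_const)
    have hSn : S.Nonempty := by
      refine ⟨r0, ⟨hr0, hr0R⟩, ?_⟩
      by_cases h1 : 0 < f r0
      · exact Or.inr (hbad h1)
      · exact Or.inl (not_lt.1 h1)
    obtain ⟨r1, hr1, hmin⟩ := hSc.exists_isLeast hSn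
    have hlt : ∀ r, 0 < r → r < r1 → 0 ≤ F r ∧ 0 ≤ G r := by
      intro r hr hrr
      have hns : r ∉ S := fun hs => absurd (hmin hs) (not_le.2 hrr)
      have hrR : r ≤ R := hrr.le.trans hr1.1.2
      have : ¬ (f r ≤ 0 ∨ g r ≤ 0) := fun hh => hns ⟨⟨hr.le, hrR⟩, hh⟩
      push Not at this
      exact h r hr hrR this.1 this.2
    have m1 := hf.mono hn (R := r1) (fun r a b => (hlt r a b).1)
      ⟨le_refl 0, hr1.1.1⟩ ⟨hr1.1.1, le_refl _⟩ hr1.1.1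
    have m2 := hg.mono hn (R := r1) (fun r a b => (hlt r a b).2)
      ⟨le_refl 0, hr1.1.1⟩ ⟨hr1.1.1, le_refl _⟩ hr1.1.1
    rcases hr1.2 with h1 | h1 <;> linarith
  intro r hr hrR
  refine ⟨(key r hr.le hrR).1, (key r hr.le hrR).2, ?_, ?_⟩
  · refine hf.deriv_nonneg hn (R := R) (fun s a b => ?_) r hr hrR
    exact (h s a b.le (key s a.le b.le).1 (key s a.le b.le).2).1
  · refine hg.deriv_nonneg hn (R := R) (fun s a b => ?_) r hr hrR
    exact (h s a b.le (key s a.le b.le).1 (key s a.le b.le).2).2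

/-- Pohozaev identity -/
lemma pohozaev {n : ℕ} (hn : 2 ≤ n) {p q : ℝ} (hp : 0 < p) (hq : 0 < q)
    (hpq : 1 / (p + 1) + 1 / (q + 1) = ((n : ℝ) - 2) / n)
    {u u1 u2 v v1 v2 : ℝ → ℝ} (up : ∀ r, 0 < u r) (vp : ∀ r, 0 < v r)
    (hu : Rad n u u1 u2 (fun r => -(v r ^ p))) (hv : Rad n v v1 v2 (fun r => -(u r ^ q)))
    (r : ℝ) (hr : 0 < r) :
    r ^ 2 * u1 r * v1 r + r ^ 2 * (1 / (p + 1) * (v r ^ p * v r) + 1 / (q + 1) * (u r ^ q * u r))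
      + r * (n * (1 / (q + 1)) * u r * v1 r + n * (1 / (p + 1)) * u1 r * v r) = 0 := by
  have hn0 : (n : ℝ) ≠ 0 := by positivity
  set A := 1 / (p + 1) with hA
  set B := 1 / (q + 1) with hB
  have hA1 : A * (p + 1) = 1 := by rw [hA]; field_simp
  have hB1 : B * (q + 1) = 1 := by rw [hB]; field_simp
  have hAB : n * A + n * B = (n : ℝ) - 2 := by
    rw [← mul_add, hpq]; field_simp
  obtain ⟨k, rfl⟩ := Nat.exists_eq_add_of_le' hn
  have hc : ((k + 2 : ℕ) : ℝ) = (k : ℝ) + 2 := by push_cast; ring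
  set E : ℝ → ℝ := fun r => r ^ (k + 2) * (u1 r * v1 r)
    + r ^ (k + 2) * (A * v r ^ (p + 1) + B * u r ^ (q + 1))
    + r ^ (k + 1) * (((k + 2 : ℕ) : ℝ) * B * (u r * v1 r) + ((k + 2 : ℕ) : ℝ) * A * (u1 r * v r))
    with hE
  have hEd : ∀ r, HasDerivAt E
      (((k + 2 : ℕ) * r ^ (k + 1)) * (u1 r * v1 r) + r ^ (k + 2) * (u2 r * v1 r + u1 r * v2 r)
      + (((k + 2 : ℕ) * r ^ (k + 1)) * (A * v r ^ (p + 1) + B * u r ^ (q + 1))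
        + r ^ (k + 2) * (A * (v1 r * (p + 1) * v r ^ p) + B * (u1 r * (q + 1) * u r ^ q)))
      + (((k + 1 : ℕ) * r ^ k) * (((k + 2 : ℕ) : ℝ) * B * (u r * v1 r) + ((k + 2 : ℕ) : ℝ) * A * (u1 r * v r))
        + r ^ (k + 1) * (((k + 2 : ℕ) : ℝ) * B * (u1 r * v1 r + u r * v2 r)
          + ((k + 2 : ℕ) : ℝ) * A * (u2 r * v r + u1 r * v1 r)))) r := by
    intro r
    have hV : HasDerivAt (fun r => v r ^ (p + 1)) (v1 r * (p + 1) * v r ^ p) r := by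
      have := (hv.d1 r).rpow_const (p := p + 1) (Or.inl (vp r).ne')
      simpa using this
    have hU : HasDerivAt (fun r => u r ^ (q + 1)) (u1 r * (q + 1) * u r ^ q) r := by
      have := (hu.d1 r).rpow_const (p := q + 1) (Or.inl (up r).ne')
      simpa using this
    have t1 := (hasDerivAt_pow (k + 2) r).mul ((hu.d2 r).mul (hv.d2 r))
    have t2 := (hasDerivAt_pow (k + 2) r).mul ((hV.const_mul A).add (hU.const_mul B))
    have t3 := (hasDerivAt_pow (k + 1) r).mul
      ((((hu.d1 r).mul (hv.d2 r)).const_mul (((k + 2 : ℕ) : ℝ) * B)).add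
      (((hu.d2 r).mul (hv.d1 r)).const_mul (((k + 2 : ℕ) : ℝ) * A)))
    have := (t1.add t2).add t3
    exact this
  have hE0 : ∀ x ∈ Set.Ico 0 r, HasDerivWithinAt E 0 (Set.Ici x) x := by
    intro s hs
    rcases hs.1.eq_or_lt with h0 | h0
    · subst h0
      refine (hEd 0).hasDerivWithinAt.congr_deriv ?_
      by_cases hk : k = 0
      · subst hk
        exfalso
        have h1 : 0 < A := by positivity
        have h2 : 0 < B := by positivity
        simp at hAB
        linarith
      · simp [hk]
    · refine (hEd s).hasDerivWithinAt.congr_deriv ?_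
      have e1 := hu.eq s h0
      have e2 := hv.eq s h0
      have e3 : v s ^ (p + 1) = v s ^ p * v s := by rw [Real.rpow_add (vp s), Real.rpow_one]
      have e4 : u s ^ (q + 1) = u s ^ q * u s := by rw [Real.rpow_add (up s), Real.rpow_one]
      rw [e3, e4]
      have hAB' : ((k : ℝ) + 2) * A + ((k : ℝ) + 2) * B = (k : ℝ) + 2 - 2 := by
        rw [← hc]; exact hAB
      rw [hc] at e1 e2 ⊢
      push_cast
      linear_combination ((s ^ (k+1)) * v1 s + s ^ k * ((k:ℝ)+2) * A * v s) * e1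
        + ((s ^ (k+1)) * u1 s + s ^ k * ((k:ℝ)+2) * B * u s) * e2
        + s ^ (k+2) * v1 s * v s ^ p * hA1 + s ^ (k+2) * u1 s * u s ^ q * hB1
        + s ^ (k+1) * u1 s * v1 s * hAB'
  have hcE : ContinuousOn E (Set.Icc 0 r) := fun s _ => (hEd s).continuousAt.continuousWithinAt
  have hfin := constant_of_has_deriv_right_zero hcE hE0 r ⟨hr.le, le_refl _⟩
  have hz : E 0 = 0 := by simp [hE]
  rw [hz] at hfin
  have e3 : v r ^ (p + 1) = v r ^ p * v r := by rw [Real.rpow_add (vp r), Real.rpow_one]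
  have e4 : u r ^ (q + 1) = u r ^ q * u r := by rw [Real.rpow_add (up r), Real.rpow_one]
  simp only [hE, e3, e4] at hfin
  have hrk : r ^ k ≠ 0 := (pow_pos hr k).ne'
  apply mul_left_cancel₀ hrk
  rw [mul_zero, ← hfin]
  ring

/-- logarithmic derivative bound for the second component -/
lemma y_bound {n : ℕ} (hn : 2 ≤ n) {v v1 v2 G : ℝ → ℝ} (vp : ∀ r, 0 < v r)
    (hv : Rad n v v1 v2 G) (hG : ∀ r, 0 < r → G r ≤ 0) (r : ℝ) (hr : 0 < r) :
    0 ≤ ((n : ℝ) - 2) * v r + r * v1 r := by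
  by_contra hneg
  push Not at hneg
  set g : ℝ → ℝ := fun r => ((n : ℝ) - 2) * v r + r * v1 r with hg
  have hgd : ∀ r, HasDerivAt g (((n : ℝ) - 2) * v1 r + (1 * v1 r + r * v2 r)) r := fun r =>
    ((hv.d1 r).const_mul _).add ((hasDerivAt_id r).mul (hv.d2 r))
  have ganti : AntitoneOn g (Set.Ici r) := by
    apply antitoneOn_of_deriv_nonpos (convex_Ici r)
    · exact fun s _ => (hgd s).continuousAt.continuousWithinAt
    · exact fun s _ => (hgd s).differentiableAt.differentiableWithinAt
    · intro s hs
      rw [interior_Ici] at hs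
      have hs0 : 0 < s := hr.trans hs
      rw [(hgd s).deriv]
      have e := hv.eq s hs0
      have := mul_nonneg hs0.le (neg_nonneg.2 (hG s hs0))
      linarith
  have hn2 : (2 : ℝ) ≤ n := by exact_mod_cast hn
  set c : ℝ := -g r with hc
  have hc0 : 0 < c := by rw [hc]; linarith
  have hhd : ∀ s, 0 < s → HasDerivAt (fun s => v s + c * Real.log s) (v1 s + c * s⁻¹) s :=
    fun s hs => (hv.d1 s).add ((Real.hasDerivAt_log hs.ne').const_mul c)
  have hanti : AntitoneOn (fun s => v s + c * Real.log s) (Set.Ici r) := by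
    apply antitoneOn_of_deriv_nonpos (convex_Ici r)
    · exact fun s hs => (hhd s (hr.trans_le hs)).continuousAt.continuousWithinAt
    · intro s hs
      rw [interior_Ici] at hs
      exact (hhd s (hr.trans hs)).differentiableAt.differentiableWithinAt
    · intro s hs
      rw [interior_Ici] at hs
      have hs0 : 0 < s := hr.trans hs
      rw [(hhd s hs0).deriv]
      have h1 : g s ≤ -c := by
        have := ganti (Set.mem_Ici.2 le_rfl) (Set.mem_Ici.2 (le_of_lt hs)) (le_of_lt hs)
        rw [hc]; linarith
      have h2 : 0 ≤ ((n : ℝ) - 2) * v s := mul_nonneg (by linarith) (vp s).le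
      have h3 : s * v1 s + c ≤ 0 := by simp only [hg] at h1; linarith
      have h4 : v1 s + c * s⁻¹ = (s * v1 s + c) * s⁻¹ := by field_simp
      rw [h4]
      exact mul_nonpos_of_nonpos_of_nonneg h3 (inv_nonneg.2 hs0.le)
  set s := r * Real.exp (v r / c) with hs
  have hrs : r ≤ s := by
    rw [hs]
    have : 1 ≤ Real.exp (v r / c) := Real.one_le_exp (div_nonneg (vp r).le hc0.le)
    nlinarith
  have hfin := hanti (Set.mem_Ici.2 le_rfl) (Set.mem_Ici.2 hrs) hrs
  simp only [hs] at hfin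
  rw [Real.log_mul hr.ne' (Real.exp_pos _).ne', Real.log_exp, mul_add, mul_div_cancel₀ _ hc0.ne'] at hfin
  have := vp (r * Real.exp (v r / c))
  linarith

/-- Tail: the decay rate persists. -/
lemma tail {n : ℕ} (hn : 5 ≤ n) {p q κ : ℝ} (hp : 0 < p) (hq : 0 < q)
    (hpq : 1 / (p + 1) + 1 / (q + 1) = ((n : ℝ) - 2) / n)
    {u u1 u2 v v1 v2 : ℝ → ℝ} (up : ∀ r, 0 < u r) (vp : ∀ r, 0 < v r)
    (hu : Rad n u u1 u2 (fun r => -(v r ^ p))) (hv : Rad n v v1 v2 (fun r => -(u r ^ q)))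
    (hκ : n * (1 / (q + 1)) ≤ κ) (hqκ : (n : ℝ) ≤ q * κ)
    (hc : 1 / 9 * (1 / (q + 1)) ≤ ((n : ℝ) - 2 - κ) * (n * (1 / (q + 1)) - 1 / (p + 1) * κ))
    {R : ℝ} (hR : 0 < R) (hP : R * u1 R + κ * u R < 0) (hY : R ^ 2 * u R ^ q < v R / 9) :
    ∀ r, R ≤ r → r * u1 r + κ * u r < 0 := by
  by_contra hcon
  push Not at hcon
  obtain ⟨r0, hr0, hbad⟩ := hcon
  set P : ℝ → ℝ := fun r => r * u1 r + κ * u r with hPdef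
  have hPd : ∀ r, HasDerivAt P (1 * u1 r + r * u2 r + κ * u1 r) r := fun r =>
    ((hasDerivAt_id r).mul (hu.d2 r)).add ((hu.d1 r).const_mul κ)
  have hPc : Continuous P := continuous_iff_continuousAt.2 fun r => (hPd r).continuousAt
  set S : Set ℝ := Set.Icc R r0 ∩ {r | 0 ≤ P r} with hS
  have hSc : IsCompact S := isCompact_Icc.inter_right (isClosed_le continuous_const hPc)
  obtain ⟨r1, hr1, hmin⟩ := hSc.exists_isLeast ⟨r0, ⟨hr0, le_rfl⟩, hbad⟩
  have hlt : ∀ r, R ≤ r → r < r1 → P r < 0 := by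
    intro r h1 h2
    by_contra h3
    exact absurd (hmin ⟨⟨h1, h2.le.trans hr1.1.2⟩, not_lt.1 h3⟩) (not_le.2 h2)
  have hRr1 : R < r1 := by
    rcases hr1.1.1.eq_or_lt with h | h
    · exfalso
      have : 0 ≤ P r1 := hr1.2
      rw [← h] at this
      simp only [hPdef] at this
      linarith
    · exact h
  have hr1p : 0 < r1 := hR.trans hRr1
  have hP1 : P r1 = 0 := by
    apply le_antisymm _ hr1.2
    have hcl : r1 ∈ closure (Set.Ico R r1) := by
      rw [closure_Ico hRr1.ne]; exact ⟨hRr1.le, le_rfl⟩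
    exact closure_minimal (fun r hr => (hlt r hr.1 hr.2).le : Set.Ico R r1 ⊆ {r | P r ≤ 0})
      (isClosed_le hPc continuous_const) hcl
  -- derivative sign
  have hP1' : 0 ≤ 1 * u1 r1 + r1 * u2 r1 + κ * u1 r1 := by
    have h1 : HasDerivWithinAt P _ (Set.Iio r1) r1 := (hPd r1).hasDerivWithinAt
    rw [hasDerivWithinAt_iff_tendsto_slope' (by simp)] at h1
    refine ge_of_tendsto h1 ?_
    have hmem : Set.Ioo R r1 ∈ 𝓝[<] r1 := Ioo_mem_nhdsLT hRr1
    filter_upwards [hmem] with r hr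
    rw [slope_def_field, hP1]
    have := hlt r hr.1.le hr.2
    rw [div_eq_mul_inv]
    have h3 : (r - r1)⁻¹ < 0 := inv_lt_zero.2 (by linarith [hr.2])
    nlinarith
  -- Y decreasing
  have hyb : ∀ r, 0 < r → 0 ≤ ((n : ℝ) - 2) * v r + r * v1 r := fun r hr =>
    y_bound (by omega) vp hv (fun r _ => by
      have := Real.rpow_pos_of_pos (up r) q; linarith) r hr
  have hYd : ∀ r, HasDerivAt (fun r => r ^ 2 * u r ^ q / v r)
      (((((2 : ℕ) * r ^ (2 - 1)) * u r ^ q + r ^ 2 * (u1 r * q * u r ^ (q - 1))) * v r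
        - (r ^ 2 * u r ^ q) * v1 r) / v r ^ 2) r := fun r =>
    (((hasDerivAt_pow 2 r).mul ((hu.d1 r).rpow_const (p := q) (Or.inl (up r).ne'))).div
      (hv.d1 r) (vp r).ne')
  have hYanti : AntitoneOn (fun r => r ^ 2 * u r ^ q / v r) (Set.Icc R r1) := by
    apply antitoneOn_of_deriv_nonpos (convex_Icc R r1)
    · exact fun s _ => (hYd s).continuousAt.continuousWithinAt
    · exact fun s _ => (hYd s).differentiableAt.differentiableWithinAt
    · intro r hr
      rw [interior_Icc] at hr
      rw [(hYd r).deriv]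
      have hr0 : 0 < r := hR.trans hr.1
      apply div_nonpos_of_nonpos_of_nonneg _ (sq_nonneg _)
      have e : u r ^ q = u r ^ (q - 1) * u r := by
        rw [← Real.rpow_add_one (up r).ne']; congr 1; ring
      have h1 := hlt r hr.1.le hr.2
      simp only [hPdef] at h1
      have h2 := hyb r hr0
      have hw : 0 < u r ^ (q - 1) := Real.rpow_pos_of_pos (up r) _
      rw [e]
      have : (((2 : ℕ) : ℝ) * r ^ (2 - 1) * (u r ^ (q - 1) * u r) + r ^ 2 * (u1 r * q * u r ^ (q - 1))) * v r
          - r ^ 2 * (u r ^ (q - 1) * u r) * v1 r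
          = r * u r ^ (q - 1) * (2 * u r * v r + q * (r * u1 r) * v r - u r * (r * v1 r)) := by
        norm_num; ring
      rw [this]
      apply mul_nonpos_of_nonneg_of_nonpos (by positivity)
      have a1 : q * v r * (r * u1 r + κ * u r) ≤ 0 :=
        mul_nonpos_of_nonneg_of_nonpos (mul_nonneg hq.le (vp r).le) h1.le
      have a2 := mul_nonneg (up r).le h2
      have a3 : 0 ≤ (q * κ - n) * (u r * v r) :=
        mul_nonneg (by linarith) (mul_nonneg (up r).le (vp r).le)
      nlinarith
  have hY1 : r1 ^ 2 * u r1 ^ q / v r1 < 1 / 9 := by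
    have := hYanti ⟨le_rfl, hRr1.le⟩ ⟨hRr1.le, le_rfl⟩ hRr1.le
    have h2 : R ^ 2 * u R ^ q / v R < 1 / 9 := by
      rw [div_lt_iff₀ (vp R)]; linarith
    exact lt_of_le_of_lt this h2
  rw [div_lt_iff₀ (vp r1)] at hY1
  have hpo := pohozaev (by omega) hp hq hpq up vp hu hv r1 hr1p
  have hy1 := hyb r1 hr1p
  have heq := hu.eq r1 hr1p
  simp only [hPdef] at hP1
  have hn0 : (n : ℝ) ≠ 0 := by positivity
  have hA0 : 0 < 1 / (p + 1) := by positivity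
  have hB0 : 0 < 1 / (q + 1) := by positivity
  generalize 1 / (p + 1) = A at *
  generalize 1 / (q + 1) = B at *
  have hAB : n * A + n * B = (n : ℝ) - 2 := by
    rw [← mul_add, hpq]; field_simp
  have hU := up r1
  have hV := vp r1
  generalize u r1 ^ q = Uq at *
  generalize v r1 ^ p = Vp at *
  -- X bound
  have hX : r1 ^ 2 * Vp ≤ κ * ((n : ℝ) - 2 - κ) * u r1 := by
    have h1 := mul_nonneg hr1p.le hP1'
    have h2 : r1 * (1 * u1 r1 + r1 * u2 r1 + κ * u1 r1)
        = κ * ((n : ℝ) - 2 - κ) * u r1 - r1 ^ 2 * Vp := by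
      linear_combination r1 * heq + (κ + 2 - n) * hP1
    linarith
  have hD : 0 ≤ (κ - n * B) * u r1 * (((n : ℝ) - 2) * v r1 + r1 * v1 r1) :=
    mul_nonneg (mul_nonneg (by linarith) hU.le) hy1
  have hru : r1 * u1 r1 = - (κ * u r1) := by linarith
  have hpo' : -(κ * u r1) * (r1 * v1 r1) + (A * (r1 ^ 2 * Vp) * v r1 + B * (r1 ^ 2 * Uq) * u r1)
      + (n * B * u r1 * (r1 * v1 r1) + n * A * (-(κ * u r1)) * v r1) = 0 := by
    rw [← hru, ← hpo]; ring
  have hX' : A * v r1 * (r1 ^ 2 * Vp) ≤ A * v r1 * (κ * ((n : ℝ) - 2 - κ) * u r1) :=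
    mul_le_mul_of_nonneg_left hX (by positivity)
  have hY' : B * u r1 * (r1 ^ 2 * Uq) < B * u r1 * (1 / 9 * v r1) :=
    mul_lt_mul_of_pos_left hY1 (by positivity)
  have hc' : 1 / 9 * B * (u r1 * v r1) ≤ ((n : ℝ) - 2 - κ) * (n * B - A * κ) * (u r1 * v r1) :=
    mul_le_mul_of_nonneg_right hc (by positivity)
  have hAB' : n * A = (n : ℝ) - 2 - n * B := by linarith
  have hAB2 : n * A * (-(κ * u r1)) * v r1 = ((n : ℝ) - 2 - n * B) * (-(κ * u r1)) * v r1 := by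
    rw [hAB']
  rw [hAB2] at hpo'
  nlinarith

lemma Rad.gauss (n : ℕ) (a b : ℝ) :
    Rad n (fun r => a * Real.exp (b * r ^ 2)) (fun r => 2 * b * r * (a * Real.exp (b * r ^ 2)))
      (fun r => (2 * b + 4 * b ^ 2 * r ^ 2) * (a * Real.exp (b * r ^ 2)))
      (fun r => (2 * n * b + 4 * b ^ 2 * r ^ 2) * (a * Real.exp (b * r ^ 2))) := by
  have h0 : ∀ r : ℝ, HasDerivAt (fun r : ℝ => a * Real.exp (b * r ^ 2))
      (2 * b * r * (a * Real.exp (b * r ^ 2))) r := by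
    intro r
    have h : HasDerivAt (fun r : ℝ => a * Real.exp (b * r ^ 2))
        (a * (Real.exp (b * r ^ 2) * (b * ((2 : ℕ) * r ^ (2 - 1))))) r :=
      (((hasDerivAt_pow 2 r).const_mul b).exp).const_mul a
    exact h.congr_deriv (by norm_num; ring)
  refine ⟨h0, fun r => ?_, fun r _ => by ring⟩
  have h : HasDerivAt (fun r : ℝ => 2 * b * r * (a * Real.exp (b * r ^ 2)))
      (2 * b * 1 * (a * Real.exp (b * r ^ 2))
        + 2 * b * r * (2 * b * r * (a * Real.exp (b * r ^ 2)))) r :=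
    ((hasDerivAt_id r).const_mul (2 * b)).mul (h0 r)
  exact h.congr_deriv (by ring)

/-- Lipschitz bound for powers on `[0,1]`, one sided. -/
lemma rpow_lip {s x y d : ℝ} (hs : 1 ≤ s) (hx0 : 0 ≤ x) (hx : x ≤ 1) (hy0 : 0 ≤ y) (hd : 0 ≤ d)
    (h : x - y ≤ d) : x ^ s - y ^ s ≤ s * d := by
  rcases le_total x y with hxy | hxy
  · have := Real.rpow_le_rpow hx0 hxy (by linarith : 0 ≤ s)
    nlinarith
  · have hmv := (convex_Icc y x).norm_image_sub_le_of_norm_deriv_le (f := fun t : ℝ => t ^ s)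
      (C := s) (x := y) (y := x) ?_ ?_ ⟨le_rfl, hxy⟩ ⟨hxy, le_rfl⟩
    · rw [Real.norm_eq_abs, Real.norm_eq_abs, abs_of_nonneg (by linarith : 0 ≤ x - y)] at hmv
      have := le_abs_self (x ^ s - y ^ s)
      have : s * (x - y) ≤ s * d := mul_le_mul_of_nonneg_left h (by linarith)
      linarith
    · intro t _
      exact (Real.hasDerivAt_rpow_const (Or.inr hs)).differentiableAt
    · intro t ht
      have ht0 : 0 ≤ t := hy0.trans ht.1
      rw [(Real.hasDerivAt_rpow_const (Or.inr hs)).deriv, Real.norm_eq_abs,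
        abs_of_nonneg (mul_nonneg (by linarith) (Real.rpow_nonneg ht0 _))]
      have := Real.rpow_le_one ht0 (ht.2.trans hx) (by linarith : 0 ≤ s - 1)
      nlinarith

/-- two approximate solutions have close shooting parameters -/
lemma shoot_close {n : ℕ} (hn : 5 ≤ n) {s δ R e : ℝ} (hs : 1 ≤ s) (hR : 0 < R) (hδ : 0 < δ)
    (hRδ : 16 * n ≤ δ * R ^ 2) (he : 0 < e) (he1 : e < 1) (heδ : 16 * e ≤ δ)
    (heR : (1 + s) * e * R ^ 2 ≤ δ / 8)
    {u u1 u2 v v1 v2 a a1 a2 b b1 b2 F G H K : ℝ → ℝ}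
    (hu : Rad n u u1 u2 F) (hv : Rad n v v1 v2 G) (ha : Rad n a a1 a2 H) (hb : Rad n b b1 b2 K)
    (u01 : ∀ r, 0 < u r ∧ u r ≤ 1) (a01 : ∀ r, 0 < a r ∧ a r ≤ 1)
    (h0 : u 0 = a 0)
    (h1 : ∀ r, 0 < r → |(F r - H r) + (v r - b r)| ≤ e)
    (h2 : ∀ r, 0 < r → |(G r - K r) + (u r ^ s - a r ^ s)| ≤ e) :
    v 0 - b 0 < δ := by
  by_contra hcon
  push Not at hcon
  have hn0 : (5 : ℝ) ≤ n := by exact_mod_cast hn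
  set M : ℝ := (1 + s) * e with hM
  have hMp : 0 < M := by positivity
  have hf := (ha.add (hu.smul (-1))).add (Rad.quad n e (-(δ / (8 * n))))
  have hg := (hv.add (hb.smul (-1))).add (Rad.quad n (-(δ / 2)) M)
  have key := Rad.comparison (by omega) hf hg (R := R) (by simp [h0, he])
    (by simp; linarith) ?_ R hR le_rfl
  · have hfR := key.1
    have e1 : δ / (8 * n) * R ^ 2 ≥ 2 := by
      rw [ge_iff_le, div_mul_eq_mul_div, le_div_iff₀ (by positivity)]; linarith
    have := (u01 R).1
    have := (a01 R).2
    linarith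
  · intro r hr hrR hfr hgr
    have hr2 : r ^ 2 ≤ R ^ 2 := by gcongr
    have hMr : M * r ^ 2 ≤ δ / 8 := le_trans (by gcongr) heR
    have t1 := abs_le.1 (h1 r hr)
    have t2 := abs_le.1 (h2 r hr)
    have e2 : 2 * (n : ℝ) * (δ / (8 * n)) = δ / 4 := by field_simp; norm_num
    constructor
    · have : 2 * (n : ℝ) * -(δ / (8 * n)) = - (δ / 4) := by rw [← e2]; ring
      rw [this]
      linarith
    · have hd : u r - a r ≤ e := by
        have : 0 ≤ δ / (8 * n) * r ^ 2 := by positivity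
        linarith
      have := rpow_lip hs (u01 r).1.le (u01 r).2 (a01 r).1.le he.le hd
      have : M ≤ 2 * n * M := by nlinarith
      linarith

/-- two approximate solutions with close data stay close (one sided) -/
lemma stay_close {n : ℕ} (hn : 5 ≤ n) {s η R e : ℝ} (hs : 1 ≤ s) (hR : 0 < R)
    (he : 0 < e) (heη : e < η)
    {u u1 u2 v v1 v2 a a1 a2 b b1 b2 F G H K : ℝ → ℝ}
    (hu : Rad n u u1 u2 F) (hv : Rad n v v1 v2 G) (ha : Rad n a a1 a2 H) (hb : Rad n b b1 b2 K)
    (u01 : ∀ r, 0 < u r ∧ u r ≤ 1) (a01 : ∀ r, 0 < a r ∧ a r ≤ 1)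
    (h0 : u 0 = a 0) (hv0 : b 0 - v 0 < η)
    (h1 : ∀ r, 0 < r → |(F r - H r) + (v r - b r)| ≤ e)
    (h2 : ∀ r, 0 < r → |(G r - K r) + (u r ^ s - a r ^ s)| ≤ e) :
    u R - a R ≤ η * Real.exp ((s + 2) * R ^ 2) ∧ b R - v R ≤ η * Real.exp ((s + 2) * R ^ 2) ∧
    u1 R - a1 R ≤ 2 * (s + 2) * R * (η * Real.exp ((s + 2) * R ^ 2)) := by
  have hn0 : (5 : ℝ) ≤ n := by exact_mod_cast hn
  have hη : 0 < η := he.trans heη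
  have hf := (ha.add (hu.smul (-1))).add (Rad.gauss n η (s + 2))
  have hg := (hv.add (hb.smul (-1))).add (Rad.gauss n η (s + 2))
  have key := Rad.comparison (by omega) hf hg (R := R) (by simp [h0, hη])
    (by simp; linarith) ?_ R hR le_rfl
  · obtain ⟨k1, k2, k3, -⟩ := key
    refine ⟨by linarith, by linarith, by linarith⟩
  · intro r hr hrR hfr hgr
    have t1 := abs_le.1 (h1 r hr)
    have t2 := abs_le.1 (h2 r hr)
    set φ := η * Real.exp ((s + 2) * r ^ 2) with hφ
    have hφη : η ≤ φ := by
      have : 1 ≤ Real.exp ((s + 2) * r ^ 2) := Real.one_le_exp (by positivity)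
      nlinarith
    have hΔ : (s + 2) * φ ≤ (2 * n * (s + 2) + 4 * (s + 2) ^ 2 * r ^ 2) * φ := by
      apply mul_le_mul_of_nonneg_right _ (by linarith)
      have : 0 ≤ 4 * (s + 2) ^ 2 * r ^ 2 := by positivity
      nlinarith
    constructor
    · nlinarith
    · have := rpow_lip hs (u01 r).1.le (u01 r).2 (a01 r).1.le (by linarith : 0 ≤ φ)
        (by linarith : u r - a r ≤ φ)
      nlinarith

lemma Rad.wpow (n : ℕ) {c : ℝ} (hc : 0 < c) (s : ℝ) :
    Rad n (fun r => (1 + c * r ^ 2) ^ (-s)) (fun r => -(2 * s * c) * r * (1 + c * r ^ 2) ^ (-(s + 1)))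
      (fun r => -(2 * s * c) * (1 + c * r ^ 2) ^ (-(s + 1))
        + 4 * s * (s + 1) * c ^ 2 * r ^ 2 * (1 + c * r ^ 2) ^ (-(s + 2)))
      (fun r => 2 * s * c * (2 * (s + 1) - n) * (1 + c * r ^ 2) ^ (-(s + 1))
        - 4 * s * (s + 1) * c * (1 + c * r ^ 2) ^ (-(s + 2))) := by
  have h0 : ∀ s r : ℝ, HasDerivAt (fun r : ℝ => (1 + c * r ^ 2) ^ (-s))
      (-(2 * s * c) * r * (1 + c * r ^ 2) ^ (-(s + 1))) r := by
    intro s r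
    have hw : 1 + c * r ^ 2 ≠ 0 := by positivity
    have h : HasDerivAt (fun r : ℝ => (1 + c * r ^ 2) ^ (-s))
        ((c * ((2 : ℕ) * r ^ (2 - 1))) * (-s) * (1 + c * r ^ 2) ^ (-s - 1)) r :=
      (((hasDerivAt_pow 2 r).const_mul c).const_add 1).rpow_const (Or.inl hw)
    refine h.congr_deriv ?_
    rw [show -s - 1 = -(s + 1) by ring]
    push_cast
    ring
  refine ⟨h0 s, fun r => ?_, fun r hr => ?_⟩
  · have h : HasDerivAt (fun r : ℝ => -(2 * s * c) * r * (1 + c * r ^ 2) ^ (-(s + 1)))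
        (-(2 * s * c) * 1 * (1 + c * r ^ 2) ^ (-(s + 1))
        + -(2 * s * c) * r * (-(2 * (s + 1) * c) * r * (1 + c * r ^ 2) ^ (-(s + 1 + 1)))) r :=
      ((hasDerivAt_id r).const_mul (-(2 * s * c))).mul (h0 (s + 1) r)
    refine h.congr_deriv ?_
    rw [show s + 1 + 1 = s + 2 by ring]
    ring
  · have hw : 0 < 1 + c * r ^ 2 := by positivity
    have e : (1 + c * r ^ 2) ^ (-(s + 1)) = (1 + c * r ^ 2) ^ (-(s + 2)) * (1 + c * r ^ 2) := by
      rw [← Real.rpow_add_one hw.ne']; congr 1; ring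
    simp only [e]
    ring

/-- The explicit bubble for `p = 1`. -/
lemma bubble {n : ℕ} (hn : 5 ≤ n) :
    ∃ a a1 a2 b b1 b2 : ℝ → ℝ,
      Rad n a a1 a2 (fun r => -b r) ∧
      Rad n b b1 b2 (fun r => -(a r ^ (((n : ℝ) + 4) / (n - 4)))) ∧
      (∀ r, 0 < a r ∧ a r ≤ 1) ∧ a 0 = 1 ∧
      ∃ R : ℝ, 0 < R ∧ R * a1 R + ((n : ℝ) - 4) * (n + 2) / (n + 4) * a R < 0 ∧
        R ^ 2 * a R ^ (((n : ℝ) + 4) / (n - 4)) < b R / 9 := by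
  have hn0 : (5 : ℝ) ≤ n := by exact_mod_cast hn
  have hT : 0 < ((n : ℝ) - 4) * (n - 2) * n * (n + 2) := by
    have : 0 < (n : ℝ) - 4 := by linarith
    have : 0 < (n : ℝ) - 2 := by linarith
    positivity
  obtain ⟨c, hc, hc2⟩ : ∃ c : ℝ, 0 < c ∧ ((n : ℝ) - 4) * (n - 2) * n * (n + 2) * c ^ 2 = 1 := by
    refine ⟨(Real.sqrt (((n : ℝ) - 4) * (n - 2) * n * (n + 2)))⁻¹, by positivity, ?_⟩
    rw [inv_pow, Real.sq_sqrt hT.le, mul_inv_cancel₀ hT.ne']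
  set m : ℝ := ((n : ℝ) - 4) / 2 with hm
  have hmp : 0 < m := by rw [hm]; linarith
  have hnm : (n : ℝ) = 2 * m + 4 := by rw [hm]; ring
  have hw : ∀ r : ℝ, 1 ≤ 1 + c * r ^ 2 := fun r => by
    have : 0 ≤ c * r ^ 2 := by positivity
    linarith
  have hpow : ∀ r : ℝ, ((1 + c * r ^ 2) ^ (-m)) ^ (((n : ℝ) + 4) / (n - 4))
      = (1 + c * r ^ 2) ^ (-(m + 4)) := by
    intro r
    rw [← Real.rpow_mul (by linarith [hw r])]
    congr 1
    rw [hnm]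
    have : 2 * m + 4 - 4 = 2 * m := by ring
    rw [this]; field_simp; ring
  have hb := (((Rad.wpow n hc (m + 1)).smul 2).add
    ((Rad.wpow n hc (m + 2)).smul ((n : ℝ) - 2))).smul (((n : ℝ) - 4) * c)
  have ha := Rad.wpow n hc m
  refine ⟨_, _, _, _, _, _, ha.congrF ?_, hb.congrF ?_, ?_, ?_, ?_⟩
  · intro r hr
    rw [hnm]
    ring
  · intro r hr
    rw [hpow r]
    have e1 : m + 1 + 1 = m + 2 := by ring
    have e2 : m + 1 + 2 = m + 3 := by ring
    have e3 : m + 2 + 1 = m + 3 := by ring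
    have e4 : m + 2 + 2 = m + 4 := by ring
    rw [hnm] at hc2 ⊢
    rw [e1, e2, e3, e4]
    linear_combination (-(1 + c * r ^ 2) ^ (-(m + 4))) * hc2
  · intro r
    refine ⟨Real.rpow_pos_of_pos (by linarith [hw r]) _, ?_⟩
    exact Real.rpow_le_one_of_one_le_of_nonpos (hw r) (by linarith)
  · simp
  · set W : ℝ := n + 4 + 9 / c ^ 2 with hW
    have h9 : 0 < 9 / c ^ 2 := by positivity
    have hW1 : 0 < (W - 1) / c := div_pos (by linarith) hc
    refine ⟨Real.sqrt ((W - 1) / c), Real.sqrt_pos.2 hW1, ?_⟩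
    set R := Real.sqrt ((W - 1) / c) with hR
    have hR2 : R ^ 2 = (W - 1) / c := Real.sq_sqrt hW1.le
    have hwW : 1 + c * R ^ 2 = W := by rw [hR2]; field_simp; ring
    have hWp : 0 < W := by linarith
    constructor
    · rw [hwW]
      have e1 : W ^ (-m) = W ^ (-(m + 1)) * W := by
        rw [← Real.rpow_add_one hWp.ne']; congr 1; ring
      rw [e1]
      have hz := Real.rpow_pos_of_pos hWp (-(m + 1))
      have : R * (-(2 * m * c) * R * W ^ (-(m + 1))) + ((n : ℝ) - 4) * (n + 2) / (n + 4) * (W ^ (-(m + 1)) * W)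
        = W ^ (-(m + 1)) * (((n : ℝ) - 4) / (n + 4)) * ((n + 2) * W - (n + 4) * (c * R ^ 2)) := by
        rw [show 2 * m = (n : ℝ) - 4 by rw [hm]; ring]
        field_simp
        ring
      rw [this]
      apply mul_neg_of_pos_of_neg
      · have : 0 < (n : ℝ) - 4 := by linarith
        positivity
      · have : c * R ^ 2 = W - 1 := by linarith
        rw [this]
        linarith
    · rw [hpow, hwW]
      have e1 : W ^ (-(m + 1)) = W ^ (-(m + 4)) * W ^ 3 := by
        rw [← Real.rpow_add_natCast hWp.ne']; congr 1; push_cast; ring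
      rw [e1]
      have hz := Real.rpow_pos_of_pos hWp (-(m + 4))
      have hz2 := Real.rpow_pos_of_pos hWp (-(m + 2))
      have hlow : (W ^ (-(m + 4))) * (2 * c * W ^ 3) ≤ ((n : ℝ) - 4) * c * (2 * (W ^ (-(m + 4)) * W ^ 3) + ((n : ℝ) - 2) * W ^ (-(m + 2))) := by
        have h1 : 0 ≤ ((n : ℝ) - 4) * c * (((n : ℝ) - 2) * W ^ (-(m + 2))) := by
          have : 0 < (n : ℝ) - 4 := by linarith
          have : 0 < (n : ℝ) - 2 := by linarith
          positivity
        have h2 : 0 ≤ ((n : ℝ) - 5) * c * (2 * (W ^ (-(m + 4)) * W ^ 3)) := by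
          have : 0 ≤ (n : ℝ) - 5 := by linarith
          positivity
        linarith
      have hmain : R ^ 2 * 9 < 2 * c * W ^ 3 := by
        rw [hR2, div_mul_eq_mul_div, div_lt_iff₀ hc]
        have h1 : 9 ≤ W * c ^ 2 := by
          have : 9 / c ^ 2 ≤ W := by linarith
          rwa [div_le_iff₀ (by positivity)] at this
        have h2 : W * 9 ≤ W * (W * c ^ 2) := mul_le_mul_of_nonneg_left h1 hWp.le
        have h3 : W * (W * c ^ 2) ≤ W * (W * c ^ 2) * W := by
          apply le_mul_of_one_le_right (by positivity); linarith
        nlinarith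
      have := mul_lt_mul_of_pos_left hmain hz
      linarith

/-- radial C² functions have radial profiles -/
lemma radial_rad {n : ℕ} (hn : 0 < n) {U : EuclideanSpace ℝ (Fin n) → ℝ} (hU : ContDiff ℝ 2 U)
    (hrad : ∀ x y, ‖x‖ = ‖y‖ → U x = U y) :
    Rad n (fun r => U (r • EuclideanSpace.single (⟨0, hn⟩ : Fin n) (1 : ℝ)))
      (fun r => fderiv ℝ U (r • EuclideanSpace.single (⟨0, hn⟩ : Fin n) (1 : ℝ))
        (EuclideanSpace.single (⟨0, hn⟩ : Fin n) (1 : ℝ)))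
      (fun r => fderiv ℝ (fderiv ℝ U) (r • EuclideanSpace.single (⟨0, hn⟩ : Fin n) (1 : ℝ))
        (EuclideanSpace.single (⟨0, hn⟩ : Fin n) (1 : ℝ))
        (EuclideanSpace.single (⟨0, hn⟩ : Fin n) (1 : ℝ)))
      (fun r => lap U (r • EuclideanSpace.single (⟨0, hn⟩ : Fin n) (1 : ℝ))) := by
  set i0 : Fin n := ⟨0, hn⟩ with hi0
  set e : EuclideanSpace ℝ (Fin n) := EuclideanSpace.single i0 (1 : ℝ) with he
  have hdU : Differentiable ℝ U := hU.differentiable (by norm_num)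
  have hdU' : Differentiable ℝ (fderiv ℝ U) :=
    (hU.fderiv_right (m := 1) (by norm_num)).differentiable (by norm_num)
  have line : ∀ (x w : EuclideanSpace ℝ (Fin n)) (t : ℝ),
      HasDerivAt (fun t : ℝ => x + t • w) w t := by
    intro x w t
    have h : HasDerivAt (fun t : ℝ => x + t • w) ((1 : ℝ) • w) t :=
      ((hasDerivAt_id t).smul_const w).const_add x
    exact h.congr_deriv (one_smul _ _)
  have D1 : ∀ (x w : EuclideanSpace ℝ (Fin n)) (t : ℝ),
      HasDerivAt (fun t : ℝ => U (x + t • w)) (fderiv ℝ U (x + t • w) w) t := fun x w t =>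
    (hdU (x + t • w)).hasFDerivAt.comp_hasDerivAt t (line x w t)
  have D2 : ∀ (x w : EuclideanSpace ℝ (Fin n)) (t : ℝ),
      HasDerivAt (fun t : ℝ => fderiv ℝ U (x + t • w) w)
        (fderiv ℝ (fderiv ℝ U) (x + t • w) w w) t := by
    intro x w t
    have h := (hdU' (x + t • w)).hasFDerivAt.comp_hasDerivAt t (line x w t)
    have h2 := h.clm_apply (hasDerivAt_const t w)
    simpa using h2
  have d1 : ∀ r : ℝ, HasDerivAt (fun r : ℝ => U (r • e)) (fderiv ℝ U (r • e) e) r := by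
    intro r; simpa using D1 0 e r
  have d2 : ∀ r : ℝ, HasDerivAt (fun r : ℝ => fderiv ℝ U (r • e) e)
      (fderiv ℝ (fderiv ℝ U) (r • e) e e) r := by
    intro r; simpa using D2 0 e r
  have hen : ‖e‖ = 1 := by simp [he]
  refine ⟨d1, d2, fun r hr => ?_⟩
  have hperp : ∀ i : Fin n, i ≠ i0 → r * fderiv ℝ (fderiv ℝ U) (r • e)
      (EuclideanSpace.single i 1) (EuclideanSpace.single i 1) = fderiv ℝ U (r • e) e := by
    intro i hi
    set w : EuclideanSpace ℝ (Fin n) := EuclideanSpace.single i (1 : ℝ) with hw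
    have hnorm : ∀ t : ℝ, ‖r • e + t • w‖ = Real.sqrt (r ^ 2 + t ^ 2) := by
      intro t
      have hin : inner ℝ (r • e) (t • w) = 0 := by
        have h0 : inner ℝ e w = 0 := by
          rw [he, hw, EuclideanSpace.inner_single_left]
          simp [Ne.symm hi]
        rw [inner_smul_left, inner_smul_right, h0]; simp
      have h3 := norm_add_sq_eq_norm_sq_add_norm_sq_of_inner_eq_zero (r • e) (t • w) hin
      rw [← Real.sqrt_mul_self (norm_nonneg (r • e + t • w)), h3]
      congr 1
      have hwn : ‖w‖ = 1 := by simp [hw]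
      rw [norm_smul, norm_smul, hen, hwn]
      simp [← sq]
    have hfun : (fun t : ℝ => U (r • e + t • w)) = fun t : ℝ => U (Real.sqrt (r ^ 2 + t ^ 2) • e) := by
      funext t
      apply hrad
      rw [hnorm, norm_smul, hen, mul_one, Real.norm_eq_abs, abs_of_nonneg (Real.sqrt_nonneg _)]
    have hsq : ∀ t : ℝ, HasDerivAt (fun t : ℝ => Real.sqrt (r ^ 2 + t ^ 2))
        (t / Real.sqrt (r ^ 2 + t ^ 2)) t := by
      intro t
      have hpos : r ^ 2 + t ^ 2 ≠ 0 := by positivity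
      have h : HasDerivAt (fun t : ℝ => Real.sqrt (r ^ 2 + t ^ 2))
          (((2 : ℕ) * t ^ (2 - 1)) / (2 * Real.sqrt (r ^ 2 + t ^ 2))) t :=
        ((hasDerivAt_pow 2 t).const_add (r ^ 2)).sqrt hpos
      refine h.congr_deriv ?_
      norm_num
      rw [mul_div_mul_left _ _ (by norm_num : (2 : ℝ) ≠ 0)]
    have hder : ∀ t : ℝ, fderiv ℝ U (r • e + t • w) w
        = t * (fderiv ℝ U (Real.sqrt (r ^ 2 + t ^ 2) • e) e / Real.sqrt (r ^ 2 + t ^ 2)) := by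
      intro t
      have hA := D1 (r • e) w t
      rw [hfun] at hA
      have hB := (d1 (Real.sqrt (r ^ 2 + t ^ 2))).comp t (hsq t)
      have := hA.unique hB
      rw [this]; ring
    have hC := D2 (r • e) w 0
    rw [funext hder] at hC
    have hs0 : Real.sqrt (r ^ 2 + 0 ^ 2) = r := by simp [Real.sqrt_sq hr.le]
    have hk0 : HasDerivAt (fun t : ℝ => fderiv ℝ U (Real.sqrt (r ^ 2 + t ^ 2) • e) e)
        (fderiv ℝ (fderiv ℝ U) (Real.sqrt (r ^ 2 + 0 ^ 2) • e) e e
          * (0 / Real.sqrt (r ^ 2 + 0 ^ 2))) 0 :=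
      HasDerivAt.comp (h₂ := fun r : ℝ => fderiv ℝ U (r • e) e) (0 : ℝ)
        (d2 (Real.sqrt (r ^ 2 + 0 ^ 2))) (hsq 0)
    have hk1 : HasDerivAt
        (fun t : ℝ => fderiv ℝ U (Real.sqrt (r ^ 2 + t ^ 2) • e) e / Real.sqrt (r ^ 2 + t ^ 2)) _ 0 :=
      hk0.div (hsq 0) (by rw [hs0]; exact hr.ne')
    have hk : HasDerivAt (fun t : ℝ => t *
        (fderiv ℝ U (Real.sqrt (r ^ 2 + t ^ 2) • e) e / Real.sqrt (r ^ 2 + t ^ 2))) _ 0 :=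
      (hasDerivAt_id (0 : ℝ)).mul hk1
    have hfin := hC.unique hk
    simp only [zero_smul, add_zero] at hfin
    rw [hfin, hs0]
    simp
    field_simp
  have hsum : r * lap U (r • e) = r * fderiv ℝ (fderiv ℝ U) (r • e) e e
      + ∑ i ∈ Finset.univ.erase i0, fderiv ℝ U (r • e) e := by
    unfold lap
    rw [← Finset.add_sum_erase _ _ (Finset.mem_univ i0), mul_add, Finset.mul_sum]
    congr 1
    apply Finset.sum_congr rfl
    intro i hi
    exact hperp i (Finset.ne_of_mem_erase hi)
  rw [hsum, Finset.sum_const, Finset.card_erase_of_mem (Finset.mem_univ i0), Finset.card_univ,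
    Fintype.card_fin, nsmul_eq_mul, Nat.cast_sub hn]
  simp

lemma rpow_unif {L s0 e : ℝ} (hs0 : 0 < s0) (he : 0 < e) :
    ∀ᶠ s in 𝓝 s0, ∀ u ∈ Set.Icc 0 L, |u ^ s - u ^ s0| < e := by
  apply isCompact_Icc.eventually_forall_of_forall_eventually
  intro y _
  have h1 : ContinuousAt (fun z : ℝ × ℝ => z.2 ^ z.1) (s0, y) := by
    have h := Real.continuousAt_rpow (y, s0) (Or.inr hs0)
    exact ContinuousAt.comp (g := fun p : ℝ × ℝ => p.1 ^ p.2) (f := fun z : ℝ × ℝ => (z.2, z.1))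
      h (continuous_snd.prodMk continuous_fst).continuousAt
  have h2 : ContinuousAt (fun z : ℝ × ℝ => z.2 ^ s0) (s0, y) :=
    (continuous_snd.rpow_const (fun _ => Or.inr hs0.le)).continuousAt
  have h3 : ContinuousAt (fun z : ℝ × ℝ => |z.2 ^ z.1 - z.2 ^ s0|) (s0, y) := (h1.sub h2).abs
  exact h3.eventually_lt continuousAt_const (by simpa using he)

/-- a priori bound of the shooting parameter -/
lemma v0_lt {n : ℕ} (hn : 5 ≤ n) {p q : ℝ} (hp : 0 < p) (hq : 0 < q)
    {u u1 u2 v v1 v2 : ℝ → ℝ} (u01 : ∀ r, 0 < u r ∧ u r ≤ 1)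
    (hu : Rad n u u1 u2 (fun r => -(v r ^ p))) (hv : Rad n v v1 v2 (fun r => -(u r ^ q))) :
    v 0 < 2 := by
  by_contra hcon
  push Not at hcon
  have hn0 : (5 : ℝ) ≤ n := by exact_mod_cast hn
  set R : ℝ := Real.sqrt (2 * n) with hR
  have hR0 : 0 < R := Real.sqrt_pos.2 (by linarith)
  have hR2 : R ^ 2 = 2 * n := Real.sq_sqrt (by linarith)
  have hk : 2 * (n : ℝ) * (1 / (2 * n)) = 1 := by field_simp
  have hv1 : ∀ r, 0 < r → r < R → 1 ≤ v r := by
    intro r hr hrR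
    have hm := (hv.add (Rad.quad n 0 (1 / (2 * n)))).mono (by omega) (R := R) (fun t _ _ => by
      rw [hk]
      have := Real.rpow_le_one (u01 t).1.le (u01 t).2 hq.le
      linarith) ⟨le_rfl, hR0.le⟩ ⟨hr.le, hrR.le⟩ hr.le
    simp only at hm
    have h2 : 1 / (2 * (n : ℝ)) * r ^ 2 ≤ 1 := by
      rw [div_mul_eq_mul_div, div_le_one (by linarith), one_mul, ← hR2]
      gcongr
    have h3 : 1 / (2 * (n : ℝ)) * 0 ^ 2 = 0 := by simp
    linarith
  have hm := ((hu.smul (-1)).add (Rad.quad n 0 (-(1 / (2 * n))))).mono (by omega) (R := R)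
    (fun t h1 h2 => by
      have := Real.one_le_rpow (hv1 t h1 h2) hp.le
      have h5 : 2 * (n : ℝ) * -(1 / (2 * n)) = -1 := by rw [mul_neg, hk]
      rw [h5]
      linarith) ⟨le_rfl, hR0.le⟩ ⟨hR0.le, le_rfl⟩ hR0.le
  simp only [hR2] at hm
  have h3 : -(1 / (2 * (n : ℝ))) * 0 ^ 2 = 0 := by simp
  have h4 : -(1 / (2 * (n : ℝ))) * (2 * n) = -1 := by field_simp
  have := (u01 R).1
  have h0 := (u01 0).2
  rw [h3, h4] at hm
  linarith

/-- pointwise decay from the logarithmic derivative bound -/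
lemma decay {n : ℕ} {q κ R : ℝ} (hq : 0 < q) (hκ : 0 < κ) (hqκ : (n : ℝ) ≤ q * κ) (hR : 0 < R)
    {u u1 : ℝ → ℝ} (u01 : ∀ r, 0 < u r ∧ u r ≤ 1) (hd : ∀ r, HasDerivAt u (u1 r) r)
    (h : ∀ r, R ≤ r → r * u1 r + κ * u r < 0) (r : ℝ) (hr : 0 ≤ r) :
    u r ^ (q + 1) ≤ (1 + R) ^ ((n : ℝ) + κ) * (1 + r) ^ (-((n : ℝ) + κ)) := by
  have hn : (0 : ℝ) ≤ n := Nat.cast_nonneg n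
  have hbase : (1 + R) ^ ((n : ℝ) + κ) * (1 + r) ^ (-((n : ℝ) + κ))
      = ((1 + R) / (1 + r)) ^ ((n : ℝ) + κ) := by
    rw [Real.div_rpow (by linarith) (by linarith), Real.rpow_neg (by linarith), div_eq_mul_inv]
  rw [hbase]
  rcases le_total r R with hrR | hrR
  · have h1 : u r ^ (q + 1) ≤ 1 := Real.rpow_le_one (u01 r).1.le (u01 r).2 (by linarith)
    have h2 : 1 ≤ (1 + R) / (1 + r) := by rw [one_le_div (by linarith)]; linarith
    exact h1.trans (Real.one_le_rpow h2 (by linarith))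
  · have hrp : 0 < r := hR.trans_le hrR
    have hdd : ∀ s, 0 < s → HasDerivAt (fun s => s ^ κ * u s)
        (κ * s ^ (κ - 1) * u s + s ^ κ * u1 s) s := fun s hs =>
      (Real.hasDerivAt_rpow_const (Or.inl hs.ne')).mul (hd s)
    have hanti : AntitoneOn (fun s => s ^ κ * u s) (Set.Ici R) := by
      apply antitoneOn_of_deriv_nonpos (convex_Ici R)
      · exact fun s hs => (hdd s (hR.trans_le hs)).continuousAt.continuousWithinAt
      · intro s hs
        rw [interior_Ici] at hs
        exact (hdd s (hR.trans hs)).differentiableAt.differentiableWithinAt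
      · intro s hs
        rw [interior_Ici] at hs
        have hs0 : 0 < s := hR.trans hs
        rw [(hdd s hs0).deriv]
        have e : s ^ κ = s ^ (κ - 1) * s := by
          rw [← Real.rpow_add_one hs0.ne']; congr 1; ring
        rw [e]
        have h1 := h s (le_of_lt hs)
        have h2 := Real.rpow_pos_of_pos hs0 (κ - 1)
        nlinarith
    have h1 := hanti (Set.mem_Ici.2 le_rfl) (Set.mem_Ici.2 hrR) hrR
    simp only at h1
    have hRk := Real.rpow_pos_of_pos hR κ
    have hrk := Real.rpow_pos_of_pos hrp κ
    have h2 : u r ≤ (R / r) ^ κ := by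
      rw [Real.div_rpow hR.le hrp.le, le_div_iff₀ hrk]
      have := (u01 R).2
      nlinarith
    have hle : R / r ≤ (1 + R) / (1 + r) := by
      rw [div_le_div_iff₀ hrp (by linarith)]; nlinarith
    have hb0 : 0 < (1 + R) / (1 + r) := by positivity
    have h3 : u r ≤ ((1 + R) / (1 + r)) ^ κ :=
      h2.trans (Real.rpow_le_rpow (by positivity) hle hκ.le)
    calc u r ^ (q + 1) ≤ (((1 + R) / (1 + r)) ^ κ) ^ (q + 1) :=
          Real.rpow_le_rpow (u01 r).1.le h3 (by linarith)
      _ = ((1 + R) / (1 + r)) ^ (κ * (q + 1)) := by rw [Real.rpow_mul hb0.le]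
      _ ≤ _ := by
          apply Real.rpow_le_rpow_of_exponent_ge hb0
          · rw [div_le_one (by linarith)]; linarith
          · nlinarith

lemma qf_one {n : ℝ} (hn : 5 ≤ n) :
    1 / ((n - 2) / n - 1 / ((1 : ℝ) + 1)) - 1 = (n + 4) / (n - 4) := by
  have h4 : n - 4 ≠ 0 := by linarith
  have h0 : n ≠ 0 := by linarith
  have hB1 : (n - 2) / n - 1 / ((1 : ℝ) + 1) = (n - 4) / (2 * n) := by field_simp; ring
  rw [hB1]; field_simp; ring

lemma qf_cont {n : ℝ} (hn : 5 ≤ n) :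
    ContinuousAt (fun p : ℝ => 1 / ((n - 2) / n - 1 / (p + 1)) - 1) 1 := by
  have h4 : n - 4 ≠ 0 := by linarith
  have h0 : n ≠ 0 := by linarith
  have hB1 : (n - 2) / n - 1 / ((1 : ℝ) + 1) = (n - 4) / (2 * n) := by field_simp; ring
  have h1 : ContinuousAt (fun p : ℝ => 1 / (p + 1)) 1 :=
    continuousAt_const.div (continuousAt_id.add continuousAt_const) (by norm_num)
  have h2 : ContinuousAt (fun p : ℝ => (n - 2) / n - 1 / (p + 1)) 1 := continuousAt_const.sub h1
  have h3 : ContinuousAt (fun p : ℝ => 1 / ((n - 2) / n - 1 / (p + 1))) 1 := by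
    refine continuousAt_const.div h2 ?_
    rw [hB1]
    positivity
  exact h3.sub continuousAt_const

lemma near_ineq {n κ : ℝ} (hn : 5 ≤ n) {qf : ℝ → ℝ}
    (hqt : Tendsto qf (𝓝 1) (𝓝 ((n + 4) / (n - 4)))) (hκ : κ = (n - 4) * (n + 2) / (n + 4)) :
    ∀ᶠ p in 𝓝 (1 : ℝ), n * (1 / (qf p + 1)) < κ ∧ n < qf p * κ ∧
      1 / 9 * (1 / (qf p + 1)) < (n - 2 - κ) * (n * (1 / (qf p + 1)) - 1 / (p + 1) * κ) := by
  have hn4 : 0 < n - 4 := by linarith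
  have hn0 : 0 < n := by linarith
  have hBv : 1 / ((n + 4) / (n - 4) + 1) = (n - 4) / (2 * n) := by
    have h : (n + 4) / (n - 4) + 1 = 2 * n / (n - 4) := by field_simp; ring
    rw [h, one_div_div]
  have hp : Tendsto (fun p : ℝ => 1 / (p + 1)) (𝓝 1) (𝓝 (1 / (1 + 1))) :=
    tendsto_const_nhds.div (tendsto_id.add tendsto_const_nhds) (by norm_num)
  have hB : Tendsto (fun p : ℝ => 1 / (qf p + 1)) (𝓝 1) (𝓝 ((n - 4) / (2 * n))) := by
    rw [← hBv]
    exact tendsto_const_nhds.div (hqt.add tendsto_const_nhds) (by positivity)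
  have hnB : n * ((n - 4) / (2 * n)) = (n - 4) / 2 := by field_simp
  have h2 : n * ((n - 4) / (2 * n)) - 1 / (1 + 1) * κ = (n - 4) / (n + 4) := by
    rw [hnB, hκ]; field_simp; ring
  have h3 : 2 ≤ n - 2 - κ := by
    have : κ ≤ n - 4 := by
      rw [hκ, div_le_iff₀ (by positivity)]
      exact mul_le_mul_of_nonneg_left (by linarith) hn4.le
    linarith
  have h4 : 0 < (n - 4) / (n + 4) := by positivity
  have h5 : 1 / 9 * ((n - 4) / (2 * n)) < 2 * ((n - 4) / (n + 4)) := by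
    rw [← mul_div_assoc, ← mul_div_assoc, div_lt_div_iff₀ (by positivity) (by positivity)]
    have : 0 < (n - 4) * (35 * n - 4) := mul_pos hn4 (by linarith)
    linarith
  have e1 : ∀ᶠ p in 𝓝 (1 : ℝ), n * (1 / (qf p + 1)) < κ := by
    refine (hB.const_mul n).eventually_lt tendsto_const_nhds ?_
    rw [hnB, hκ, div_lt_div_iff₀ (by positivity) (by positivity), mul_assoc]
    exact mul_lt_mul_of_pos_left (by linarith) hn4
  have e2 : ∀ᶠ p in 𝓝 (1 : ℝ), n < qf p * κ := by
    refine tendsto_const_nhds.eventually_lt (hqt.mul_const κ) ?_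
    have : (n + 4) / (n - 4) * κ = n + 2 := by rw [hκ]; field_simp
    rw [this]; linarith
  have e3 : ∀ᶠ p in 𝓝 (1 : ℝ), 1 / 9 * (1 / (qf p + 1))
      < (n - 2 - κ) * (n * (1 / (qf p + 1)) - 1 / (p + 1) * κ) := by
    refine (hB.const_mul (1 / 9)).eventually_lt
      (((hB.const_mul n).sub (hp.mul_const κ)).const_mul (n - 2 - κ)) ?_
    rw [h2]
    exact h5.trans_le (mul_le_mul_of_nonneg_right h3 h4.le)
  filter_upwards [e1, e2, e3] with p a b c using ⟨a, b, c⟩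

set_option maxHeartbeats 1000000 in
theorem uniform_integral_bound_near_one (n : ℕ) (hn : 5 ≤ n) :
    ∃ ε₀ : ℝ, 0 < ε₀ ∧ ∃ C : ℝ, 0 < C ∧
      ∀ p q : ℝ, 0 < p → 0 < q →
        1 / (p + 1) + 1 / (q + 1) = ((n : ℝ) - 2) / n →
        |p - 1| ≤ ε₀ →
        ∀ U V : EuclideanSpace ℝ (Fin n) → ℝ, IsGroundState n p q U V →
          ∫⁻ x, ENNReal.ofReal (U x ^ (q + 1)) ≤ ENNReal.ofReal C := by
  have hn0 : (5 : ℝ) ≤ n := by exact_mod_cast hn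
  obtain ⟨a, a1, a2, b, b1, b2, ha, hb, a01, a0, R, hR, hG1, hG2⟩ := bubble hn
  set s : ℝ := ((n : ℝ) + 4) / (n - 4) with hs
  set κ : ℝ := ((n : ℝ) - 4) * (n + 2) / (n + 4) with hκ
  have hn4 : 0 < (n : ℝ) - 4 := by linarith
  have hs1 : 1 ≤ s := by rw [hs, one_le_div hn4]; linarith
  have hκp : 0 < κ := by rw [hκ]; positivity
  set E := Real.exp ((s + 2) * R ^ 2) with hE
  have hE1 : 1 ≤ E := Real.one_le_exp (by positivity)
  -- choice of η
  set C1 : ℝ := R * (2 * (s + 2) * R * E) + κ * E with hC1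
  set C2 : ℝ := R ^ 2 * ((s + 1) * E) + E / 9 with hC2
  have hC1p : 0 < C1 := by positivity
  have hC2p : 0 < C2 := by positivity
  obtain ⟨η, hη, hη1, hη2⟩ : ∃ η : ℝ, 0 < η ∧ η * C1 < -(R * a1 R + κ * a R) ∧
      η * C2 < b R / 9 - R ^ 2 * a R ^ s := by
    have g1 : 0 < -(R * a1 R + κ * a R) := by linarith
    have g2 : 0 < b R / 9 - R ^ 2 * a R ^ s := by linarith
    generalize -(R * a1 R + κ * a R) = x1 at *
    generalize b R / 9 - R ^ 2 * a R ^ s = x2 at *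
    refine ⟨min (x1 / C1) (x2 / C2) / 2, by positivity, ?_, ?_⟩
    · have h1 : min (x1 / C1) (x2 / C2) ≤ x1 / C1 := min_le_left _ _
      rw [le_div_iff₀ hC1p] at h1
      linarith
    · have h1 : min (x1 / C1) (x2 / C2) ≤ x2 / C2 := min_le_right _ _
      rw [le_div_iff₀ hC2p] at h1
      linarith
  -- auxiliary radius and error
  set R' : ℝ := 16 * n / η + 1 with hR'
  have hR'p : 0 < R' := by positivity
  have hR'1 : 16 * (n : ℝ) ≤ η * R' ^ 2 := by
    have h1 : 16 * (n : ℝ) / η ≤ R' := by linarith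
    have h2 : (1 : ℝ) ≤ R' := by
      have : 0 ≤ 16 * (n : ℝ) / η := by positivity
      linarith
    have h3 : R' ≤ R' ^ 2 := by nlinarith
    rw [div_le_iff₀ hη] at h1
    nlinarith
  set D : ℝ := 16 * (1 + s) * R' ^ 2 + 16 + 16 * η with hD
  have hDp : 0 < D := by positivity
  set e : ℝ := η / D with he
  have hep : 0 < e := by positivity
  have heD : e * D = η := by rw [he]; field_simp
  have q1 : 0 ≤ e * ((1 + s) * R' ^ 2) := by positivity
  have q2 : 0 < e * η := by positivity
  have hexp : e * D = 16 * (e * ((1 + s) * R' ^ 2)) + 16 * e + 16 * (e * η) := by rw [hD]; ring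
  have he1 : e < 1 := by
    rw [he, div_lt_one hDp, hD]
    have : 0 ≤ 16 * (1 + s) * R' ^ 2 := by positivity
    linarith
  have he2 : 16 * e ≤ η := by linarith
  have he3 : (1 + s) * e * R' ^ 2 ≤ η / 8 := by linarith
  have he4 : e < η := by linarith
  -- closeness in `p`
  set qf : ℝ → ℝ := fun p => 1 / (((n : ℝ) - 2) / n - 1 / (p + 1)) - 1 with hqf
  have hqt : Tendsto qf (𝓝 1) (𝓝 s) := by
    have h := qf_cont hn0
    have h1 := qf_one hn0
    unfold ContinuousAt at h
    simp only at h
    rw [h1] at h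
    exact h
  have ev1 : ∀ᶠ p in 𝓝 (1 : ℝ), ∀ v ∈ Set.Icc (0 : ℝ) 2, |v ^ p - v ^ (1 : ℝ)| < e :=
    rpow_unif one_pos hep
  have ev2 : ∀ᶠ p in 𝓝 (1 : ℝ), ∀ u ∈ Set.Icc (0 : ℝ) 1, |u ^ (qf p) - u ^ s| < e :=
    hqt.eventually (rpow_unif (by linarith) hep)
  have ev3 : ∀ᶠ p in 𝓝 (1 : ℝ), n * (1 / (qf p + 1)) < κ ∧ (n : ℝ) < qf p * κ ∧
      1 / 9 * (1 / (qf p + 1))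
        < ((n : ℝ) - 2 - κ) * (n * (1 / (qf p + 1)) - 1 / (p + 1) * κ) :=
    near_ineq hn0 hqt hκ
  obtain ⟨ε, hε, hball⟩ := Metric.eventually_nhds_iff.1
    (ev1.and (ev2.and ev3))
  have hintg : Integrable (fun x : EuclideanSpace ℝ (Fin n) =>
      (1 + R) ^ ((n : ℝ) + κ) * (1 + ‖x‖) ^ (-((n : ℝ) + κ))) :=
    (integrable_one_add_norm (by simp [hκp])).const_mul _
  have hpos : ∀ x : EuclideanSpace ℝ (Fin n),
      0 ≤ (1 + R) ^ ((n : ℝ) + κ) * (1 + ‖x‖) ^ (-((n : ℝ) + κ)) := fun x => by positivity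
  refine ⟨ε / 2, by positivity, (∫ x : EuclideanSpace ℝ (Fin n),
      (1 + R) ^ ((n : ℝ) + κ) * (1 + ‖x‖) ^ (-((n : ℝ) + κ))) + 1, ?_, ?_⟩
  · have := integral_nonneg (μ := volume) (f := fun x : EuclideanSpace ℝ (Fin n) =>
      (1 + R) ^ ((n : ℝ) + κ) * (1 + ‖x‖) ^ (-((n : ℝ) + κ))) hpos
    linarith
  intro p q hp hq hpq hpε U V hGS
  obtain ⟨hUc, hVc, hUp, hVp, hU, hV, hUm, hVm, -, -, hU0⟩ := hGS
  have hqq : q = qf p := by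
    have : ((n : ℝ) - 2) / n - 1 / (p + 1) = 1 / (q + 1) := by linarith
    simp only [hqf]
    rw [this]; field_simp; ring
  obtain ⟨c1, c2, c3, c4, c5⟩ := hball (y := p) (by rw [Real.dist_eq]; linarith)
  rw [← hqq] at c2 c3 c4 c5
  have hnpos : 0 < n := by omega
  have hu := (radial_rad hnpos hUc (fun x y h => le_antisymm (hUm y x h.ge) (hUm x y h.le)))
  have hv := (radial_rad hnpos hVc (fun x y h => le_antisymm (hVm y x h.ge) (hVm x y h.le)))
  set w : EuclideanSpace ℝ (Fin n) := EuclideanSpace.single (⟨0, hnpos⟩ : Fin n) (1 : ℝ) with hw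
  have hwn : ‖w‖ = 1 := by simp [hw]
  replace hu := hu.congrF (G := fun r => -((V (r • w)) ^ p)) (fun r _ => by
    have := hU (r • w); linarith)
  replace hv := hv.congrF (G := fun r => -((U (r • w)) ^ q)) (fun r _ => by
    have := hV (r • w); linarith)
  set u : ℝ → ℝ := fun r => U (r • w) with hudef
  set v : ℝ → ℝ := fun r => V (r • w) with hvdef
  have up : ∀ r, 0 < u r := fun r => hUp _
  have vp : ∀ r, 0 < v r := fun r => hVp _
  have u01 : ∀ r, 0 < u r ∧ u r ≤ 1 := fun r => ⟨up r, by
    rw [← hU0]; exact hUm _ _ (by simp)⟩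
  have hu0 : u 0 = 1 := by simp [hudef, hU0]
  have hv2 : v 0 < 2 := v0_lt hn hp hq u01 hu hv
  have vle : ∀ r, v r ≤ 2 := fun r => le_trans (hVm (0 • w) (r • w) (by simp)) (by
    have : v 0 = V ((0 : ℝ) • w) := rfl
    simp at this ⊢
    linarith)
  have err1 : ∀ r, |v r ^ p - v r| < e := fun r => by
    have := c1 (v r) ⟨(vp r).le, vle r⟩
    rwa [Real.rpow_one] at this
  have err2 : ∀ r, |u r ^ q - u r ^ s| < e := fun r => c2 (u r) ⟨(up r).le, (u01 r).2⟩
  have hsh : b 0 - v 0 < η := by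
    refine shoot_close hn hs1 hR'p hη hR'1 hep he1 he2 he3 ha hb hu hv a01 u01
      (by rw [a0, hu0]) (fun r _ => ?_) (fun r _ => ?_)
    · have := err1 r
      have e1 : -b r - -(v r ^ p) + (b r - v r) = v r ^ p - v r := by ring
      rw [e1]; exact this.le
    · have := err2 r
      have e1 : -a r ^ s - -(u r ^ q) + (a r ^ s - u r ^ s) = u r ^ q - u r ^ s := by ring
      rw [e1]; exact this.le
  obtain ⟨k1, k2, k3⟩ := stay_close hn hs1 hR hep he4 hu hv ha hb u01 a01 (by rw [a0, hu0]) hsh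
    (fun r _ => by
      have := err1 r
      have e1 : -(v r ^ p) - -b r + (v r - b r) = -(v r ^ p - v r) := by ring
      show |-(v r ^ p) - -b r + (v r - b r)| ≤ e
      rw [e1, abs_neg]; exact this.le)
    (fun r _ => by
      have := err2 r
      have e1 : -(u r ^ q) - -(a r ^ s) + (u r ^ s - a r ^ s) = -(u r ^ q - u r ^ s) := by ring
      show |-(u r ^ q) - -(a r ^ s) + (u r ^ s - a r ^ s)| ≤ e
      rw [e1, abs_neg]; exact this.le)
  rw [← hE] at k1 k2 k3
  have htail := tail hn hp hq hpq up vp hu hv c3.le c4.le c5.le hR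
    (by
      have h1 := mul_le_mul_of_nonneg_left k3 hR.le
      have h2 := mul_le_mul_of_nonneg_left k1 hκp.le
      rw [hC1] at hη1
      linarith)
    (by
      have h1 := (abs_lt.1 (err2 R)).2
      have h2 := rpow_lip hs1 (up R).le (u01 R).2 (a01 R).1.le (by positivity) k1
      have h3 : u R ^ q ≤ a R ^ s + (s + 1) * (η * E) := by
        have : η ≤ η * E := by nlinarith
        linarith
      have h4 := mul_le_mul_of_nonneg_left h3 (sq_nonneg R)
      rw [hC2] at hη2
      linarith)
  have hpt : ∀ x, U x ^ (q + 1) ≤ (1 + R) ^ ((n : ℝ) + κ) * (1 + ‖x‖) ^ (-((n : ℝ) + κ)) := by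
    intro x
    have h1 := decay hq hκp c4.le hR u01 hu.d1 htail ‖x‖ (norm_nonneg x)
    have h2 : U x = u ‖x‖ := by
      have h3 : ‖x‖ = ‖(‖x‖ • w)‖ := by rw [norm_smul, hwn]; simp
      exact le_antisymm (hUm _ _ h3.ge) (hUm _ _ h3.le)
    rw [h2]; exact h1
  calc ∫⁻ x, ENNReal.ofReal (U x ^ (q + 1))
      ≤ ∫⁻ x : EuclideanSpace ℝ (Fin n),
        ENNReal.ofReal ((1 + R) ^ ((n : ℝ) + κ) * (1 + ‖x‖) ^ (-((n : ℝ) + κ))) :=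
        lintegral_mono fun x => ENNReal.ofReal_le_ofReal (hpt x)
    _ = ENNReal.ofReal (∫ x : EuclideanSpace ℝ (Fin n),
        (1 + R) ^ ((n : ℝ) + κ) * (1 + ‖x‖) ^ (-((n : ℝ) + κ))) :=
        (ofReal_integral_eq_lintegral_ofReal hintg (Filter.Eventually.of_forall hpos)).symm
    _ ≤ _ := ENNReal.ofReal_le_ofReal (by linarith)
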